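/- arXiv:1105.1213 — 2 statements merged into one kernel-verified Lean document; each statement's English description precedes it below -/
import Mathlib

section
/- For the graph of f(x) = t₀ + ε(1+r²)^{-1/2} in the half-de Sitter spacetime (-dt² + e^{2t/λ}δ) on ℝ × ℝ³, the mean curvature satisfies tr_g K = 3/λ + (ε²/(2λ)) r²(1+r²)^{-3} e^{-2f/λ} + O(r^{-5}) as r → ∞. In particular if ε ≠ 0 then tr_g K > 3/λ for all sufficiently large r. -/
lemma pg_fderiv (a : ℝ) (x : EuclideanSpace ℝ (Fin 3)) :
    HasFDerivAt (fun y : EuclideanSpace ℝ (Fin 3) => (1 + ‖y‖^2) ^ a)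
      ((a * (1 + ‖x‖^2) ^ (a - 1)) • ((2 : ℝ) • innerSL ℝ x)) x := by
  have h1 : HasFDerivAt (fun y : EuclideanSpace ℝ (Fin 3) => 1 + ‖y‖^2)
      ((2 : ℝ) • innerSL ℝ x) x := by
    have := (hasStrictFDerivAt_norm_sq x).hasFDerivAt.const_add 1
    have e : (2 : ℝ) • innerSL ℝ x = (2 : ℕ) • innerSL ℝ x := by
      ext v; simp
    rw [e]; exact this
  exact h1.rpow_const (Or.inl (by positivity))

lemma pg_inner (x : EuclideanSpace ℝ (Fin 3)) (i : Fin 3) :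
    inner ℝ x (EuclideanSpace.single i (1:ℝ)) = x i := by
  simp [EuclideanSpace.inner_single_right]

lemma pg_coord (x : EuclideanSpace ℝ (Fin 3)) (i : Fin 3) :
    HasFDerivAt (fun y : EuclideanSpace ℝ (Fin 3) => y i)
      (EuclideanSpace.proj i : EuclideanSpace ℝ (Fin 3) →L[ℝ] ℝ) x :=
  (EuclideanSpace.proj i : EuclideanSpace ℝ (Fin 3) →L[ℝ] ℝ).hasFDerivAt

lemma pg_pd (t₀ ε : ℝ) (f : EuclideanSpace ℝ (Fin 3) → ℝ)
    (hf : ∀ x, f x = t₀ + ε * (1 + ‖x‖^2) ^ (-(1/2) : ℝ)) (i : Fin 3)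
    (x : EuclideanSpace ℝ (Fin 3)) :
    fderiv ℝ f x (EuclideanSpace.single i 1) = -ε * ((1 + ‖x‖^2) ^ (-(3/2) : ℝ) * x i) := by
  have h := ((pg_fderiv (-(1/2)) x).const_mul ε).const_add t₀
  rw [funext hf, h.fderiv]
  simp only [_root_.smul_apply, innerSL_apply_apply, pg_inner, smul_eq_mul]
  rw [show (-(1/2) - 1 : ℝ) = -(3/2) by norm_num]
  ring

lemma pg_pd2 (t₀ ε : ℝ) (f : EuclideanSpace ℝ (Fin 3) → ℝ)
    (hf : ∀ x, f x = t₀ + ε * (1 + ‖x‖^2) ^ (-(1/2) : ℝ)) (i j : Fin 3)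
    (x : EuclideanSpace ℝ (Fin 3)) :
    fderiv ℝ (fun y => fderiv ℝ f y (EuclideanSpace.single j 1)) x
      (EuclideanSpace.single i 1) =
      -ε * ((1 + ‖x‖^2) ^ (-(3/2) : ℝ) * (if i = j then 1 else 0)
        - 3 * (1 + ‖x‖^2) ^ (-(5/2) : ℝ) * x i * x j) := by
  have e : (fun y => fderiv ℝ f y (EuclideanSpace.single j 1)) =
      fun y => -ε * ((1 + ‖y‖^2) ^ (-(3/2) : ℝ) * y j) := funext fun y => pg_pd t₀ ε f hf j y
  rw [e]
  have h := ((pg_fderiv (-(3/2)) x).mul (pg_coord x j)).const_mul (-ε)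
  have h' : fderiv ℝ (fun y : EuclideanSpace ℝ (Fin 3) =>
      -ε * ((1 + ‖y‖^2) ^ (-(3/2) : ℝ) * y j)) x = _ := HasFDerivAt.fderiv h
  rw [h']
  simp only [_root_.smul_apply, _root_.add_apply, innerSL_apply_apply,
    pg_inner, smul_eq_mul]
  have hpr : (EuclideanSpace.proj j : EuclideanSpace ℝ (Fin 3) →L[ℝ] ℝ)
      (EuclideanSpace.single i 1) = if i = j then 1 else 0 := by
    by_cases hij : i = j
    · subst hij; simp
    · have hji : ¬ j = i := fun h => hij h.symm
      simp [hij, hji]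
  rw [hpr]
  have : (-(3/2) - 1 : ℝ) = -(5/2) := by norm_num
  rw [this]
  ring

/-- Trace formula, purely algebraic. -/
lemma pg_trace (lam E F m : ℝ) (p : Fin 3 → ℝ) (H D g K : Matrix (Fin 3) (Fin 3) ℝ)
    (S : Fin 3 → Matrix (Fin 3) (Fin 3) ℝ)
    (hEF : E * F = 1) (w : ℝ) (hw : w = F * ∑ i, p i ^ 2) (hw1 : 1 - w ≠ 0)
    (hD : ∀ i j, D i j = H i j + (E / lam) * (if i = j then 1 else 0))
    (hS : ∀ k i j, S k i j = (1 / lam)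
      * (p i * (if k = j then 1 else 0) + p j * (if k = i then 1 else 0)))
    (hK : ∀ i j, K i j = -(m * (-(D i j) + ∑ k, E * (F * p k) * S k i j)))
    (hg : ∀ i j, g i j = -(p i * p j) + E * (if i = j then 1 else 0)) :
    Matrix.trace (g⁻¹ * K) = m * (F * ∑ i, H i i + 3 / lam - w / (1 - w) / lam
      + F^2 / (1 - w) * ∑ i, ∑ j, H i j * p i * p j) := by
  have hinv : g⁻¹ = Matrix.of fun i j => F * (if i = j then 1 else 0)
      + F^2 / (1 - w) * (p i * p j) := by
    apply Matrix.inv_eq_right_inv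
    ext i j
    have key : ∑ k, p k * p k = E * w := by
      rw [hw, ← mul_assoc, hEF, one_mul]; exact Finset.sum_congr rfl fun _ _ => by ring
    have : (g * (Matrix.of fun i j => F * (if i = j then 1 else 0)
        + F^2 / (1 - w) * (p i * p j) : Matrix (Fin 3) (Fin 3) ℝ)) i j
        = (E * F) * (if i = j then 1 else 0) - F * (p i * p j)
          - F^2 / (1 - w) * (p i * p j) * (∑ k, p k * p k)
          + E * F^2 / (1 - w) * (p i * p j) := by
      simp only [Matrix.mul_apply, Matrix.of_apply, hg, Fin.sum_univ_three]
      fin_cases i <;> fin_cases j <;> simp <;> ring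
    rw [this, key, hEF, Matrix.one_apply]
    have h2 : E * F^2 = F := by rw [pow_two, ← mul_assoc, hEF, one_mul]
    have h3 : F^2 / (1 - w) * (p i * p j) * (E * w) = F * w / (1 - w) * (p i * p j) := by
      rw [show F^2 / (1 - w) * (p i * p j) * (E * w) = (E * F^2) * w / (1 - w) * (p i * p j) by ring,
        h2]
    rw [h3, h2]
    field_simp
    ring
  have hK' : ∀ i j, K i j = m * (H i j + (E / lam) * (if i = j then 1 else 0)
      - 2 / lam * (p i * p j)) := by
    intro i j
    have h1 : ∀ k, E * (F * p k) * S k i j = p k * S k i j := fun k => by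
      rw [← mul_assoc E, hEF, one_mul]
    rw [hK, hD]
    simp only [h1]
    simp only [hS]
    simp only [Fin.sum_univ_three]
    fin_cases i <;> fin_cases j <;> simp <;> ring
  rw [hinv]
  have key : p 0 ^ 2 + p 1 ^ 2 + p 2 ^ 2 = E * w := by
    rw [hw, ← mul_assoc, hEF, one_mul, Fin.sum_univ_three]
  have tr : Matrix.trace ((Matrix.of fun i j => F * (if i = j then 1 else 0)
      + F^2 / (1 - w) * (p i * p j) : Matrix (Fin 3) (Fin 3) ℝ) * K) = m * (F * ∑ i, H i i + 3 * (E * F) / lam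
        - 2 / lam * F * (p 0 ^ 2 + p 1 ^ 2 + p 2 ^ 2)
        + F^2 / (1 - w) * (∑ i, ∑ j, H i j * p i * p j)
        + F^2 / (1 - w) * (E / lam * (p 0 ^ 2 + p 1 ^ 2 + p 2 ^ 2)
          - 2 / lam * (p 0 ^ 2 + p 1 ^ 2 + p 2 ^ 2)^2)) := by
    simp only [Matrix.trace, Matrix.diag, Matrix.mul_apply, Matrix.of_apply, hK',
      Fin.sum_univ_three]
    simp
    ring
  rw [tr, key, hEF]
  have h4 : F^2 / (1 - w) * (E / lam * (E * w) - 2 / lam * (E * w)^2)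
      = (E * F)^2 * (w / lam - 2 / lam * w^2) / (1 - w) := by ring
  have h5 : 2 / lam * F * (E * w) = 2 / lam * (E * F) * w := by ring
  rw [h4, h5, hEF]
  by_cases hl : lam = 0
  · subst hl; simp
  field_simp
  ring

lemma pg_m (w m : ℝ) (h0 : 0 ≤ w) (h1 : w ≤ 1/2) (hm : m = (1 - w) ^ (-(1/2) : ℝ)) :
    0 ≤ m ∧ m ≤ 3/2 ∧ |m * (3 - w / (1 - w)) - 3 - w / 2| ≤ 12 * w^2 := by
  set n := Real.sqrt (1 - w) with hn
  have hn2 : n^2 = 1 - w := Real.sq_sqrt (by linarith)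
  have hn0 : 0 < n := Real.sqrt_pos.2 (by linarith)
  have hn1 : n ≤ 1 := by nlinarith
  have hn7 : 2/3 ≤ n := by nlinarith
  have hmn : m = 1 / n := by
    rw [hm, Real.rpow_neg (by linarith), ← Real.sqrt_eq_rpow, one_div]
  refine ⟨by rw [hmn]; positivity, ?_, ?_⟩
  · rw [hmn, div_le_iff₀ hn0]; linarith
  have hw : w = 1 - n^2 := by linarith
  have e : m * (3 - w / (1 - w)) - 3 - w / 2
      = (1 - n)^2 * ((n^3 + 2*n^2 - 4*n - 2) / (2 * n^3)) := by
    rw [hmn, ← hn2, hw]; field_simp; ring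
  rw [e, abs_mul, abs_of_nonneg (sq_nonneg _), mul_comm]
  have hn3 : 1/4 ≤ n^3 := by nlinarith [mul_nonneg hn0.le hn0.le]
  have b1 : |(n^3 + 2*n^2 - 4*n - 2) / (2 * n^3)| ≤ 12 := by
    rw [abs_div, abs_of_pos (show 0 < 2 * n^3 by positivity), div_le_iff₀ (by positivity)]
    have : n^3 ≤ 1 := pow_le_one₀ hn0.le hn1
    rw [abs_le]; constructor <;> nlinarith
  have b2 : (1 - n)^2 ≤ w^2 := by
    apply pow_le_pow_left₀ (by linarith); nlinarith
  exact mul_le_mul b1 b2 (sq_nonneg _) (by norm_num)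

/-- Radial estimate. -/
lemma pg_est (lam ε F F0 q r w m T : ℝ) (hlam : 0 < lam) (hF : 0 < F) (hF0 : F ≤ F0)
    (hq : 0 < q) (hr : 1 ≤ r) (hqr : q^2 * (1 + r^2) = 1)
    (hw : w = F * (ε^2 * q^6 * r^2)) (hR : 1 + 2 * (ε^2 * F0) ≤ r)
    (hm : m = (1 - w) ^ (-(1/2) : ℝ))
    (hT : T = m * (F * (-3 * ε * q^5) + 3 / lam - w / (1 - w) / lam
      + F^2 / (1 - w) * (-ε^3 * (q^9 * r^2 - 3 * q^11 * r^4)))) :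
    |T - (3 / lam + w / (2 * lam))| ≤
      (12 / lam * (ε^2 * F0)^2 + 9/2 * |ε| * F0 + 6 * |ε|^3 * F0^2) * r⁻¹ ^ 5 := by
  have hr0 : 0 < r := by linarith
  have hF00 : 0 < F0 := hF.trans_le hF0
  have ha1 : q^2 * r^2 ≤ 1 := by nlinarith [sq_nonneg q]
  have ha0 : 0 ≤ q^2 * r^2 := by positivity
  have hqri : q ≤ r⁻¹ := by
    rw [← one_div, le_div_iff₀ hr0]
    have : (q * r)^2 ≤ 1 := by rw [mul_pow]; exact ha1
    nlinarith [mul_pos hq hr0]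
  have hri1 : r⁻¹ ≤ 1 := inv_le_one_of_one_le₀ hr
  have hq1 : q ≤ 1 := hqri.trans hri1
  have hw0 : 0 ≤ w := by rw [hw]; positivity
  have hwq : w ≤ ε^2 * F0 * q^4 := by
    rw [hw]
    calc F * (ε^2 * q^6 * r^2) = F * (ε^2 * q^4) * (q^2 * r^2) := by ring
      _ ≤ F0 * (ε^2 * q^4) * 1 := by gcongr
      _ = _ := by ring
  have hq4 : q^4 ≤ r⁻¹ := (pow_le_of_le_one hq.le hq1 (by norm_num)).trans hqri
  have hw1 : w ≤ 1/2 := by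
    have : ε^2 * F0 * q^4 ≤ ε^2 * F0 * r⁻¹ := by gcongr
    have h2 : ε^2 * F0 * r⁻¹ ≤ 1/2 := by
      rw [← div_eq_mul_inv, div_le_iff₀ hr0]; linarith
    linarith
  obtain ⟨m0, m1, m2⟩ := pg_m w m hw0 hw1 hm
  have hq5 : q^5 ≤ r⁻¹^5 := by gcongr
  have e : T - (3 / lam + w / (2 * lam)) = (m * (3 - w / (1 - w)) - 3 - w / 2) / lam
      + m * (F * (-3 * ε * q^5))
      + m * (F^2 * (1 / (1 - w)) * (-ε^3 * (q^5 * (q^2 * ((q^2 * r^2) * (1 - 3 * (q^2 * r^2))))))) := by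
    rw [hT]; field_simp; ring
  have t1 : |(m * (3 - w / (1 - w)) - 3 - w / 2) / lam| ≤ 12 / lam * (ε^2 * F0)^2 * q^5 := by
    rw [abs_div, abs_of_pos hlam, div_le_iff₀ hlam]
    refine m2.trans ?_
    have : w^2 ≤ (ε^2 * F0 * q^4)^2 := by gcongr
    have h8 : q^8 ≤ q^5 := pow_le_pow_of_le_one hq.le hq1 (by norm_num)
    calc 12 * w^2 ≤ 12 * ((ε^2 * F0)^2 * q^8) := by nlinarith
      _ ≤ 12 * ((ε^2 * F0)^2 * q^5) := by gcongr
      _ = _ := by field_simp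
  have t2 : |m * (F * (-3 * ε * q^5))| ≤ 9/2 * |ε| * F0 * q^5 := by
    rw [abs_mul, abs_mul, abs_mul, abs_mul, abs_of_nonneg m0, abs_of_pos hF,
      abs_of_pos (show 0 < q^5 by positivity)]
    calc _ ≤ 3/2 * (F0 * (|(-3:ℝ)| * |ε| * q^5)) := by gcongr
      _ = _ := by norm_num; ring
  have t3 : |m * (F^2 * (1 / (1 - w)) * (-ε^3 * (q^5 * (q^2 * ((q^2 * r^2) * (1 - 3 * (q^2 * r^2)))))))|
      ≤ 6 * |ε|^3 * F0^2 * q^5 := by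
    have hi : 1 / (1 - w) ≤ 2 := by rw [div_le_iff₀ (by linarith)]; linarith
    have hi0 : 0 ≤ 1 / (1 - w) := by apply div_nonneg <;> linarith
    have hb : |1 - 3 * (q^2 * r^2)| ≤ 2 := by rw [abs_le]; constructor <;> linarith
    have hc : q^2 ≤ 1 := pow_le_one₀ hq.le hq1
    simp only [abs_mul, abs_neg, abs_pow, abs_of_nonneg m0, abs_of_pos hF, abs_of_nonneg hi0,
      abs_of_pos hq, abs_of_pos hr0]
    calc _ ≤ 3/2 * (F0^2 * 2 * (|ε|^3 * (q^5 * (1 * (1 * 2))))) := by gcongr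
      _ = _ := by ring
  rw [e]
  have hpos : 0 ≤ 12 / lam * (ε^2 * F0)^2 + 9/2 * |ε| * F0 + 6 * |ε|^3 * F0^2 := by positivity
  calc _ ≤ _ := abs_add_three _ _ _
    _ ≤ (12 / lam * (ε^2 * F0)^2 + 9/2 * |ε| * F0 + 6 * |ε|^3 * F0^2) * q^5 := by linarith
    _ ≤ _ := by gcongr

open Finset

/-- For the graph of `f(x) = t₀ + ε(1+r²)^{-1/2}` in the half-de Sitter
spacetime `(ℝ × ℝ³, -dt² + e^{2t/λ}δ)` (so `ρ(t) = e^{t/λ}`, `ρρ' = e^{2t/λ}/λ`,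
`ρ'/ρ = 1/λ`), with second fundamental form `K i j = -⟨∇̃_{Xᵢ}Xⱼ, ν⟩` (computed from the
ambient Christoffel symbols, `ν = μ(∂_t + ρ⁻²∇f)` the future timelike unit normal) and
induced metric `gᵢⱼ = -∂ᵢf∂ⱼf + e^{2f/λ}δᵢⱼ`, the mean curvature satisfies
`tr_g K = 3/λ + (ε²/(2λ)) r²(1+r²)^{-3} e^{-2f/λ} + O(r^{-5})` as `r → ∞`; in particular
if `ε ≠ 0` then `tr_g K > 3/λ` for all sufficiently large `r`. -/
theorem mean_curvature_of_planar_graph (lam t₀ ε : ℝ) (hlam : 0 < lam)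
    (f : EuclideanSpace ℝ (Fin 3) → ℝ)
    (hf : ∀ x, f x = t₀ + ε * (1 + ‖x‖^2) ^ (-(1/2) : ℝ))
    (pd : Fin 3 → EuclideanSpace ℝ (Fin 3) → ℝ)
    (hpd : ∀ i x, pd i x = fderiv ℝ f x (EuclideanSpace.single i 1))
    (pd2 : Fin 3 → Fin 3 → EuclideanSpace ℝ (Fin 3) → ℝ)
    (hpd2 : ∀ i j x, pd2 i j x
      = fderiv ℝ (fun y => fderiv ℝ f y (EuclideanSpace.single j 1)) x
          (EuclideanSpace.single i 1))
    (μ : EuclideanSpace ℝ (Fin 3) → ℝ)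
    (hμ : ∀ x, μ x = (1 - Real.exp (-2 * f x / lam) * ∑ i, (pd i x)^2) ^ (-(1/2) : ℝ))
    (Dt : EuclideanSpace ℝ (Fin 3) → Matrix (Fin 3) (Fin 3) ℝ)
    (hDt : ∀ x i j, Dt x i j = pd2 i j x
      + (Real.exp (2 * f x / lam) / lam) * (if i = j then 1 else 0))
    (Ds : EuclideanSpace ℝ (Fin 3) → Fin 3 → Matrix (Fin 3) (Fin 3) ℝ)
    (hDs : ∀ x k i j, Ds x k i j = (1 / lam)
      * (pd i x * (if k = j then 1 else 0) + pd j x * (if k = i then 1 else 0)))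
    (K : EuclideanSpace ℝ (Fin 3) → Matrix (Fin 3) (Fin 3) ℝ)
    (hK : ∀ x i j, K x i j = -(μ x * (-(Dt x i j)
      + ∑ k, Real.exp (2 * f x / lam) * (Real.exp (-2 * f x / lam) * pd k x)
          * Ds x k i j)))
    (g : EuclideanSpace ℝ (Fin 3) → Matrix (Fin 3) (Fin 3) ℝ)
    (hg : ∀ x i j, g x i j = -(pd i x * pd j x)
      + Real.exp (2 * f x / lam) * (if i = j then 1 else 0))
    (trK : EuclideanSpace ℝ (Fin 3) → ℝ)
    (htrK : ∀ x, trK x = Matrix.trace ((g x)⁻¹ * K x)) :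
    (∃ C R₀ : ℝ, ∀ x, R₀ ≤ ‖x‖ →
      |trK x - (3 / lam + ε^2 / (2 * lam) * ‖x‖^2 * ((1 + ‖x‖^2)^3)⁻¹
          * Real.exp (-2 * f x / lam))| ≤ C * ‖x‖⁻¹ ^ 5) ∧
    (ε ≠ 0 → ∃ R₁ : ℝ, ∀ x, R₁ ≤ ‖x‖ → 3 / lam < trK x) := by
  have hmain : ∃ C R₀ : ℝ, ∀ x, R₀ ≤ ‖x‖ →
      |trK x - (3 / lam + ε^2 / (2 * lam) * ‖x‖^2 * ((1 + ‖x‖^2)^3)⁻¹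
          * Real.exp (-2 * f x / lam))| ≤ C * ‖x‖⁻¹ ^ 5 := by
    set F0 := Real.exp (-2 * (t₀ - |ε|) / lam) with hF0
    refine ⟨12 / lam * (ε^2 * F0)^2 + 9/2 * |ε| * F0 + 6 * |ε|^3 * F0^2,
      1 + 2 * (ε^2 * F0), fun x hx => ?_⟩
    have hF0p : 0 < F0 := Real.exp_pos _
    have hr : 1 ≤ ‖x‖ := by nlinarith [mul_nonneg (sq_nonneg ε) hF0p.le]
    set q := (1 + ‖x‖^2) ^ (-(1/2) : ℝ) with hq
    have hA : 0 < 1 + ‖x‖^2 := by positivity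
    have hq0 : 0 < q := Real.rpow_pos_of_pos hA _
    have hpow : ∀ n : ℕ, q ^ n = (1 + ‖x‖^2) ^ (-(1/2) * n : ℝ) := fun n => by
      rw [hq, ← Real.rpow_natCast, ← Real.rpow_mul hA.le]
    have hq3 : (1 + ‖x‖^2) ^ (-(3/2) : ℝ) = q^3 := by rw [hpow]; norm_num
    have hq5 : (1 + ‖x‖^2) ^ (-(5/2) : ℝ) = q^5 := by rw [hpow]; norm_num
    have hq2 : q^2 = (1 + ‖x‖^2)⁻¹ := by rw [hpow, ← Real.rpow_neg_one]; norm_num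
    have hqr : q^2 * (1 + ‖x‖^2) = 1 := by rw [hq2]; exact inv_mul_cancel₀ hA.ne'
    have hq1 : q ≤ 1 := by nlinarith [sq_nonneg (q * ‖x‖)]
    set F := Real.exp (-2 * f x / lam) with hF
    have hFp : 0 < F := Real.exp_pos _
    have hFF0 : F ≤ F0 := by
      rw [hF, hF0]
      apply Real.exp_le_exp.2
      apply div_le_div_of_nonneg_right _ hlam.le
      have : -|ε| ≤ ε * q := by
        have h1 : |ε * q| ≤ |ε| := by
          rw [abs_mul, abs_of_pos hq0]; exact mul_le_of_le_one_right (abs_nonneg _) hq1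
        linarith [neg_abs_le (ε * q)]
      rw [hf x]; linarith
    have hEF : Real.exp (2 * f x / lam) * F = 1 := by
      rw [hF, ← Real.exp_add]; simp; ring
    have hn : ‖x‖^2 = x 0 ^ 2 + x 1 ^ 2 + x 2 ^ 2 := by
      rw [EuclideanSpace.real_norm_sq_eq, Fin.sum_univ_three]
    have hp : ∀ i, pd i x = -ε * (q^3 * x i) := fun i => by
      rw [hpd, pg_pd t₀ ε f hf, hq3]
    have hH : ∀ i j, pd2 i j x = -ε * (q^3 * (if i = j then 1 else 0)
        - 3 * q^5 * x i * x j) := fun i j => by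
      rw [hpd2, pg_pd2 t₀ ε f hf, hq3, hq5]
    have hs : ∑ i, (pd i x)^2 = ε^2 * q^6 * ‖x‖^2 := by
      simp only [hp, Fin.sum_univ_three, hn]; ring
    set w := F * ∑ i, (pd i x)^2 with hw
    have hw' : w = F * (ε^2 * q^6 * ‖x‖^2) := by rw [hw, hs]
    have hw1 : 1 - w ≠ 0 := by
      have : w ≤ ε^2 * F0 * q^4 := by
        rw [hw']
        have ha1 : q^2 * ‖x‖^2 ≤ 1 := by nlinarith [sq_nonneg q]
        calc F * (ε^2 * q^6 * ‖x‖^2) = F * (ε^2 * q^4) * (q^2 * ‖x‖^2) := by ring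
          _ ≤ F0 * (ε^2 * q^4) * 1 := by gcongr
          _ = _ := by ring
      have h4 : q^4 ≤ q^2 := pow_le_pow_of_le_one hq0.le hq1 (by norm_num)
      have h5 : ε^2 * F0 * q^4 ≤ ε^2 * F0 * q^2 := by gcongr
      have h6 : ε^2 * F0 * q^2 < 1 := by
        rw [hq2, ← div_eq_mul_inv, div_lt_one hA]
        nlinarith [mul_nonneg (sq_nonneg ε) hF0p.le]
      linarith
    have htr := pg_trace lam (Real.exp (2 * f x / lam)) F (μ x) (fun i => pd i x)
      (Matrix.of fun i j => pd2 i j x) (Dt x) (g x) (K x) (Ds x) hEF w hw hw1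
      (fun i j => hDt x i j) (fun k i j => hDs x k i j) (fun i j => hK x i j)
      (fun i j => hg x i j)
    have hlap : ∑ i, (Matrix.of fun i j => pd2 i j x) i i = -3 * ε * q^5 := by
      have : q^3 = q^5 * (1 + ‖x‖^2) := by
        rw [show q^5 * (1 + ‖x‖^2) = q^3 * (q^2 * (1 + ‖x‖^2)) by ring, hqr, mul_one]
      simp only [Matrix.of_apply, hH, Fin.sum_univ_three, if_true, this, hn]
      ring
    have hHpp : ∑ i, ∑ j, (Matrix.of fun i j => pd2 i j x) i j * pd i x * pd j x
        = -ε^3 * (q^9 * ‖x‖^2 - 3 * q^11 * ‖x‖^4) := by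
      rw [show ‖x‖^4 = (‖x‖^2)^2 by ring]
      simp only [Matrix.of_apply, hH, hp, Fin.sum_univ_three, hn]
      simp
      ring
    rw [hlap, hHpp, ← htrK] at htr
    have hest := pg_est lam ε F F0 q ‖x‖ w (μ x) (trK x) hlam hFp hFF0 hq0 hr hqr hw' hx
      (hμ x) htr
    have e : ε^2 / (2 * lam) * ‖x‖^2 * ((1 + ‖x‖^2)^3)⁻¹ * F = w / (2 * lam) := by
      rw [hw', ← inv_pow, ← hq2]; ring
    rw [e]; exact hest
  refine ⟨hmain, fun hε => ?_⟩
  obtain ⟨C, R₀, h⟩ := hmain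
  set F1 := Real.exp (-2 * (t₀ + |ε|) / lam) with hF1
  have hF1p : 0 < F1 := Real.exp_pos _
  set c := ε^2 / (16 * lam) * F1 with hc
  have hcp : 0 < c := by positivity
  refine ⟨max (max 1 R₀) (|C| / c + 1), fun x hx => ?_⟩
  have hx1 : 1 ≤ ‖x‖ := (le_max_left _ _).trans ((le_max_left _ _).trans hx)
  have hxR : R₀ ≤ ‖x‖ := (le_max_right _ _).trans ((le_max_left _ _).trans hx)
  have hxC : |C| / c < ‖x‖ := by linarith [(le_max_right _ _).trans hx]
  have hr0 : 0 < ‖x‖ := by linarith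
  have h1 := (abs_le.1 (h x hxR)).1
  have hFF : F1 ≤ Real.exp (-2 * f x / lam) := by
    rw [hF1]
    apply Real.exp_le_exp.2
    apply div_le_div_of_nonneg_right _ hlam.le
    have hq1 : (1 + ‖x‖^2) ^ (-(1/2) : ℝ) ≤ 1 :=
      Real.rpow_le_one_of_one_le_of_nonpos (by nlinarith) (by norm_num)
    have hq0 : 0 < (1 + ‖x‖^2) ^ (-(1/2) : ℝ) := Real.rpow_pos_of_pos (by positivity) _
    have : ε * (1 + ‖x‖^2) ^ (-(1/2) : ℝ) ≤ |ε| := by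
      refine (le_abs_self _).trans ?_
      rw [abs_mul, abs_of_pos hq0]; exact mul_le_of_le_one_right (abs_nonneg _) hq1
    rw [hf x]; linarith
  have hcube : ((2 * ‖x‖^2)^3)⁻¹ ≤ ((1 + ‖x‖^2)^3)⁻¹ := by
    gcongr
    nlinarith
  have h2 : c * ‖x‖⁻¹^4 ≤ ε^2 / (2 * lam) * ‖x‖^2 * ((1 + ‖x‖^2)^3)⁻¹
      * Real.exp (-2 * f x / lam) := by
    calc c * ‖x‖⁻¹^4 = ε^2 / (2 * lam) * ‖x‖^2 * ((2 * ‖x‖^2)^3)⁻¹ * F1 := by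
          rw [hc]; field_simp; norm_num
      _ ≤ _ := by gcongr
  have h3 : C * ‖x‖⁻¹^5 < c * ‖x‖⁻¹^4 := by
    have h4 : C < c * ‖x‖ := by
      rw [div_lt_iff₀ hcp] at hxC
      linarith [le_abs_self C]
    calc C * ‖x‖⁻¹^5 < c * ‖x‖ * ‖x‖⁻¹^5 := by gcongr
      _ = _ := by field_simp
  linarith
end

section
/- In the setting of the hyperbolic graph f = T₀ + ε e^{-3R/λ}, the mass aspect function E = ∇^{H,j} ḡ_{1j} - ∇^H_1 tr_{ğ_H}(ḡ) + (1/λ)(a₂₂ + a₃₃) + 2(h̄₂₂ + h̄₃₃) satisfies E = (16ε/λ²) tanh(T₀/(2λ)) e^{-3R/λ} + O(e^{-5R/λ}) as R → ∞. -/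
open Filter Topology Asymptotics

/-- Second order Taylor bound at `0`. -/
theorem mass_taylor_bound (G : ℝ → ℝ) (m : ℝ) (hG : AnalyticAt ℝ G 0) (h0 : G 0 = 0)
    (hd : HasDerivAt G m 0) :
    (fun y => G y - m * y) =O[𝓝 0] (fun y => y ^ 2) := by
  obtain ⟨p, hp⟩ := hG
  have h1 := (hp.has_fpower_series_dslope_fslope).analyticAt.differentiableAt
  have h2 := h1.isBigO_sub
  have h3 : dslope G 0 0 = m := by rw [dslope_same, hd.deriv]
  have h4 := (isBigO_refl (fun y : ℝ => y) (𝓝 0)).mul h2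
  refine (h4.congr_left ?_).congr_right ?_
  · intro y
    rw [h3]
    have := sub_smul_dslope G 0 y
    simp only [sub_zero, smul_eq_mul, h0] at this
    linear_combination this
  · intro y; simp; ring

noncomputable def massMu (l T e y : ℝ) : ℝ :=
  (1 - (-3 * e * y / l)^2 / (Real.sinh ((T + e * y) / l))^2) ^ (-(1/2) : ℝ)

noncomputable def massG (l T e y : ℝ) : ℝ :=
  12 * e * y / l^2 * (Real.sinh (T / l))⁻¹^2 * (Real.sinh ((T + e * y) / l) * Real.cosh ((T + e * y) / l))
  + (2 / l) * ((Real.sinh (T / l))⁻¹^2 * (Real.sinh ((T + e * y) / l))^2 - 1)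
  + 4 * (Real.sinh (T / l))⁻¹ * (massMu l T e y * ((1 / l) * (-3 * e * y / l)
      + (1 / l) * Real.sinh ((T + e * y) / l) * Real.cosh ((T + e * y) / l))
      - (Real.cosh (T / l) / Real.sinh (T / l) / l) * (Real.sinh ((T + e * y) / l))^2)
  - (2 / l) * (Real.sinh (T / l))⁻¹^2 * (9 * e^2 / l^2) * y^2

theorem massMu_analytic (l T e : ℝ) (hs : Real.sinh (T / l) ≠ 0) :
    AnalyticAt ℝ (massMu l T e) 0 := by
  unfold massMu
  have hb : AnalyticAt ℝ (fun y : ℝ => Real.sinh ((T + e * y) / l)) 0 := by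
    fun_prop
  have hb2 : AnalyticAt ℝ (fun y : ℝ => 1 - (-3 * e * y / l)^2 / (Real.sinh ((T + e * y) / l))^2) 0 := by
    refine analyticAt_const.sub (AnalyticAt.div (by fun_prop) (hb.pow 2) ?_)
    simpa using hs
  exact (ContDiffAt.rpow_const_of_ne (n := ⊤) hb2.contDiffAt (by simp)).analyticAt

theorem massMu_zero (l T e : ℝ) : massMu l T e 0 = 1 := by
  simp [massMu]

theorem massMu_deriv (l T e : ℝ) (hs : Real.sinh (T / l) ≠ 0) :
    HasDerivAt (massMu l T e) 0 0 := by
  have hsh : HasDerivAt (fun y : ℝ => Real.sinh ((T + e * y) / l)) (Real.cosh ((T + e * 0) / l) * (e * 1 / l)) 0 :=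
    ((((hasDerivAt_id (0:ℝ)).const_mul e).const_add T).div_const l).sinh
  have hn : HasDerivAt (fun y : ℝ => -3 * e * y / l) (-3 * e * 1 / l) 0 :=
    ((hasDerivAt_id (0:ℝ)).const_mul (-3 * e)).div_const l
  have hq := ((hn.pow 2).div (hsh.pow 2) (by simpa using hs)).const_sub 1
  have := hq.rpow_const (p := (-(1/2) : ℝ)) (by left; simp)
  refine this.congr_deriv ?_
  simp

theorem massG_taylor (l T e : ℝ) (hl : l ≠ 0) (hs : Real.sinh (T / l) ≠ 0) :
    (fun y => massG l T e y - (16 * e / l^2) * Real.tanh (T / (2 * l)) * y) =O[𝓝 0]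
      (fun y => y ^ 2) := by
  apply mass_taylor_bound
  · have := massMu_analytic l T e hs
    unfold massG
    fun_prop
  · simp [massG, massMu_zero]
    field_simp
    ring
  · have hsh : HasDerivAt (fun y : ℝ => Real.sinh ((T + e * y) / l)) (Real.cosh ((T + e * 0) / l) * (e * 1 / l)) 0 :=
      ((((hasDerivAt_id (0:ℝ)).const_mul e).const_add T).div_const l).sinh
    have hch : HasDerivAt (fun y : ℝ => Real.cosh ((T + e * y) / l)) (Real.sinh ((T + e * 0) / l) * (e * 1 / l)) 0 :=
      ((((hasDerivAt_id (0:ℝ)).const_mul e).const_add T).div_const l).cosh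
    have hn : HasDerivAt (fun y : ℝ => -3 * e * y / l) (-3 * e * 1 / l) 0 :=
      ((hasDerivAt_id (0:ℝ)).const_mul (-3 * e)).div_const l
    have hn2 : HasDerivAt (fun y : ℝ => 12 * e * y / l^2) (12 * e * 1 / l^2) 0 :=
      ((hasDerivAt_id (0:ℝ)).const_mul (12 * e)).div_const (l^2)
    have hm := massMu_deriv l T e hs
    have h1 := (hn2.mul_const ((Real.sinh (T / l))⁻¹^2)).mul (hsh.mul hch)
    have h2 := (((hsh.pow 2).const_mul ((Real.sinh (T / l))⁻¹^2)).sub_const 1).const_mul (2 / l)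
    have h3 := ((hm.mul ((hn.const_mul (1 / l)).add ((hsh.const_mul (1/l)).mul hch))).sub
      ((hsh.pow 2).const_mul (Real.cosh (T / l) / Real.sinh (T / l) / l))).const_mul (4 * (Real.sinh (T / l))⁻¹)
    have h4 := ((hasDerivAt_id (0:ℝ)).pow 2).const_mul ((2 / l) * (Real.sinh (T / l))⁻¹^2 * (9 * e^2 / l^2))
    have h5 := ((h1.add h2).add h3).sub h4
    refine (h5.congr_deriv ?_)
    have hu : T / l = 2 * (T / (2 * l)) := by field_simp
    have hs' : Real.sinh (T / (2*l)) ≠ 0 := by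
      intro h; apply hs; rw [hu, Real.sinh_two_mul, h]; simp
    have hc' : Real.cosh (T / (2*l)) ≠ 0 := (Real.cosh_pos _).ne'
    have hcs := Real.cosh_sq (T / (2*l))
    simp [massMu_zero]
    rw [hu, Real.sinh_two_mul, Real.cosh_two_mul, Real.tanh_eq_sinh_div_cosh]
    generalize Real.sinh (T / (2*l)) = a at *
    generalize Real.cosh (T / (2*l)) = b at *
    field_simp
    have hb4 : b ^ 4 = (a ^ 2 + 1) ^ 2 := by rw [← hcs]; ring
    ring_nf
    ring_nf at hb4
    simp only [hb4, hcs]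
    ring

theorem mass_coth_bound (t : ℝ) (ht : 1 ≤ t) :
    |Real.cosh t / Real.sinh t - 1| ≤ 4 * Real.exp (-t) ^ 2 := by
  have hpos : 0 < Real.sinh t := Real.sinh_pos_iff.2 (by linarith)
  have h1 : Real.cosh t / Real.sinh t - 1 = Real.exp (-t) / Real.sinh t := by
    rw [← Real.cosh_sub_sinh]; field_simp
  rw [h1, abs_of_pos (div_pos (Real.exp_pos _) hpos), div_le_iff₀ hpos, Real.sinh_eq]
  have h2 : Real.exp (-t) * Real.exp t = 1 := by rw [← Real.exp_add]; simp
  have h3 : 2 ≤ Real.exp t := by linarith [Real.add_one_le_exp t]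
  have h4 := Real.exp_pos (-t)
  have h5 : Real.exp (-t) ≤ 1 / 2 := by nlinarith
  have h6 : 4 * Real.exp (-t) ^ 2 * ((Real.exp t - Real.exp (-t)) / 2)
      = 2 * Real.exp (-t) - 2 * Real.exp (-t) ^ 3 := by
    linear_combination (2 * Real.exp (-t)) * h2
  rw [h6]
  have h7 : Real.exp (-t) ^ 2 ≤ 1 / 4 := by nlinarith
  nlinarith

theorem mass_tendsto (l : ℝ) (hl : 0 < l) :
    Tendsto (fun R : ℝ => Real.exp (-3 * R / l)) atTop (𝓝 0) := by
  have : (fun R : ℝ => Real.exp (-3 * R / l)) = fun R => Real.exp (-((3 / l) * R)) := by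
    funext R; congr 1; ring
  rw [this]
  exact Real.tendsto_exp_neg_atTop_nhds_zero.comp
    (tendsto_id.const_mul_atTop (by positivity))

/-- In the setting of the hyperbolic graph `f = T₀ + ε e^{-3R/λ}`
(`T₀ ≠ 0`, `λ > 0`), with rescaled metric components `ḡ₁₁ = H⁻²(sinh²(f/λ) -
(9ε²/λ²)e^{-6R/λ})`, `ḡ₂₂ = ḡ₃₃ = H⁻² sinh²(f/λ)` (`H = sinh(T₀/λ)`), `a = ḡ - ğ_H`, the
divergence `∇^{H,j}ḡ₁ⱼ = ∂_R ḡ₁₁ - (2/λ)coth(R/λ)ḡ₂₂ + (2/λ)coth(R/λ)ḡ₁₁` (from the frame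
Christoffel symbols), `∇^H₁ tr_{ğ_H}ḡ = ∂_R(ḡ₁₁ + 2ḡ₂₂)`, the frame component
`K₂₂ = μ((1/λ)coth(R/λ)f' + (1/λ)sinh(f/λ)cosh(f/λ))` of the second fundamental form and
`h̄₂₂ = h̄₃₃ = H⁻¹(K₂₂ - (coth(T₀/λ)/λ)g₂₂)`, the mass aspect function
`E = ∇^{H,j}ḡ₁ⱼ - ∇^H₁ tr_{ğ_H}(ḡ) + (1/λ)(a₂₂ + a₃₃) + 2(h̄₂₂ + h̄₃₃)` satisfies
`E = (16ε/λ²) tanh(T₀/(2λ)) e^{-3R/λ} + O(e^{-5R/λ})` as `R → ∞`. -/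
theorem mass_aspect_of_hyperbolic_graph (lam T₀ ε : ℝ) (hlam : 0 < lam) (hT₀ : T₀ ≠ 0)
    (f : ℝ → ℝ) (hf : ∀ R, f R = T₀ + ε * Real.exp (-3 * R / lam))
    (H : ℝ) (hH : H = Real.sinh (T₀ / lam))
    (bg11 bg22 : ℝ → ℝ)
    (hbg11 : ∀ R, bg11 R = H⁻¹^2
      * ((Real.sinh (f R / lam))^2 - (9 * ε^2 / lam^2) * Real.exp (-6 * R / lam)))
    (hbg22 : ∀ R, bg22 R = H⁻¹^2 * (Real.sinh (f R / lam))^2)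
    (a22 : ℝ → ℝ) (ha22 : ∀ R, a22 R = bg22 R - 1)
    (div1 : ℝ → ℝ)
    (hdiv1 : ∀ R, div1 R = deriv bg11 R
      - (2 / lam) * (Real.cosh (R / lam) / Real.sinh (R / lam)) * bg22 R
      + (2 / lam) * (Real.cosh (R / lam) / Real.sinh (R / lam)) * bg11 R)
    (gradtr : ℝ → ℝ)
    (hgradtr : ∀ R, gradtr R = deriv (fun R => bg11 R + 2 * bg22 R) R)
    (μ : ℝ → ℝ)
    (hμ : ∀ R, μ R = (1 - (deriv f R)^2 / (Real.sinh (f R / lam))^2) ^ (-(1/2) : ℝ))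
    (K22 : ℝ → ℝ)
    (hK22 : ∀ R, K22 R = μ R
      * ((Real.cosh (R / lam) / Real.sinh (R / lam) / lam) * deriv f R
        + (1 / lam) * Real.sinh (f R / lam) * Real.cosh (f R / lam)))
    (hbar22 : ℝ → ℝ)
    (hhbar22 : ∀ R, hbar22 R = H⁻¹ * (K22 R
      - (Real.cosh (T₀ / lam) / Real.sinh (T₀ / lam) / lam)
        * (Real.sinh (f R / lam))^2))
    (E : ℝ → ℝ)
    (hE : ∀ R, E R = div1 R - gradtr R + (1 / lam) * (a22 R + a22 R)
      + 2 * (hbar22 R + hbar22 R)) :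
    ∃ C R₀ : ℝ, ∀ R, R₀ ≤ R →
      |E R - (16 * ε / lam^2) * Real.tanh (T₀ / (2 * lam)) * Real.exp (-3 * R / lam)|
        ≤ C * Real.exp (-5 * R / lam) := by
  have hs : Real.sinh (T₀ / lam) ≠ 0 := by
    rw [Ne, Real.sinh_eq_zero]; exact div_ne_zero hT₀ hlam.ne'
  have hl := hlam.ne'
  subst hH
  obtain ⟨c1, hc1⟩ := (massG_taylor lam T₀ ε hl hs).bound
  have hbc : ContinuousAt (fun y => -(2 / lam) * (Real.sinh (T₀ / lam))⁻¹^2 * (9 * ε^2 / lam^2) * y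
      + 4 * (Real.sinh (T₀ / lam))⁻¹ * massMu lam T₀ ε y * (1 / lam) * (-3 * ε / lam)) 0 := by
    have := (massMu_analytic lam T₀ ε hs).continuousAt
    fun_prop
  obtain ⟨c2, hc2⟩ := (hbc.norm.isBoundedUnder_le).eventually_le
  have hT := mass_tendsto lam hlam
  obtain ⟨R₀, hR₀⟩ := eventually_atTop.1 ((hT.eventually hc1).and
    ((hT.eventually hc2).and (eventually_ge_atTop lam)))
  refine ⟨|c1| + 4 * |c2|, R₀, fun R hR => ?_⟩
  obtain ⟨k1, k2, k3⟩ := hR₀ R hR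
  have hcoth := mass_coth_bound (R / lam) ((one_le_div hlam).2 k3)
  have e3 : Real.exp (-3 * R / lam) = Real.exp (-(R / lam)) ^ 3 := by
    rw [← Real.exp_nat_mul]; congr 1; push_cast; ring
  have e5 : Real.exp (-5 * R / lam) = Real.exp (-(R / lam)) ^ 5 := by
    rw [← Real.exp_nat_mul]; congr 1; push_cast; ring
  have e6 : Real.exp (-6 * R / lam) = Real.exp (-3 * R / lam) ^ 2 := by
    rw [← Real.exp_nat_mul]; congr 1; push_cast; ring
  have hx1 : Real.exp (-(R / lam)) ≤ 1 := by
    rw [Real.exp_le_one_iff]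
    have := (one_le_div hlam).2 k3
    linarith
  have hx0 := Real.exp_pos (-(R / lam))
  -- derivatives
  have hdy : ∀ r, HasDerivAt (fun R : ℝ => Real.exp (-3 * R / lam))
      (Real.exp (-3 * r / lam) * (-3 * 1 / lam)) r := fun r =>
    (((hasDerivAt_id r).const_mul (-3)).div_const lam).exp
  have hdy6 : HasDerivAt (fun R : ℝ => Real.exp (-6 * R / lam))
      (Real.exp (-6 * R / lam) * (-6 * 1 / lam)) R :=
    (((hasDerivAt_id R).const_mul (-6)).div_const lam).exp
  have hdf : HasDerivAt f (ε * (Real.exp (-3 * R / lam) * (-3 * 1 / lam))) R := by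
    rw [funext hf]
    exact ((hdy R).const_mul ε).const_add T₀
  have hdS := ((hdf.div_const lam).sinh).pow 2
  have hd22 : DifferentiableAt ℝ bg22 R := by
    rw [funext hbg22]
    exact (hdS.const_mul _).differentiableAt
  have hd11 : DifferentiableAt ℝ bg11 R := by
    rw [funext hbg11]
    exact ((hdS.sub (hdy6.const_mul _)).const_mul _).differentiableAt
  have hdb22 : deriv bg22 R = (Real.sinh (T₀ / lam))⁻¹^2 * (2 * Real.sinh (f R / lam)
      * (Real.cosh (f R / lam) * (ε * (Real.exp (-3 * R / lam) * (-3 * 1 / lam)) / lam))) := by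
    have := (hdS.const_mul ((Real.sinh (T₀ / lam))⁻¹^2)).deriv
    rw [funext hbg22]
    refine this.trans ?_
    simp
  have hgr : gradtr R = deriv bg11 R + 2 * deriv bg22 R := by
    rw [hgradtr]
    exact (hd11.hasDerivAt.add (hd22.hasDerivAt.const_mul 2)).deriv
  have hmu : μ R = massMu lam T₀ ε (Real.exp (-3 * R / lam)) := by
    rw [hμ, massMu, hdf.deriv, hf]
    have h0 : ε * (Real.exp (-3 * R / lam) * (-3 * 1 / lam))
        = -3 * ε * Real.exp (-3 * R / lam) / lam := by ring
    rw [h0]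
  have key : E R = massG lam T₀ ε (Real.exp (-3 * R / lam))
      + (Real.cosh (R / lam) / Real.sinh (R / lam) - 1) * (Real.exp (-3 * R / lam)
        * (-(2 / lam) * (Real.sinh (T₀ / lam))⁻¹^2 * (9 * ε^2 / lam^2) * Real.exp (-3 * R / lam)
      + 4 * (Real.sinh (T₀ / lam))⁻¹ * massMu lam T₀ ε (Real.exp (-3 * R / lam)) * (1 / lam) * (-3 * ε / lam))) := by
    rw [hE, hgr, hdiv1, ha22, hhbar22, hK22, hmu, hdb22, hdf.deriv, hbg11, hbg22, hf, e6, massG]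
    generalize Real.cosh (R / lam) / Real.sinh (R / lam) = q
    ring
  rw [Real.norm_eq_abs, Real.norm_eq_abs] at k1
  rw [Real.norm_eq_abs] at k2
  rw [key]
  generalize (-(2 / lam) * (Real.sinh (T₀ / lam))⁻¹^2 * (9 * ε^2 / lam^2) * Real.exp (-3 * R / lam)
      + 4 * (Real.sinh (T₀ / lam))⁻¹ * massMu lam T₀ ε (Real.exp (-3 * R / lam)) * (1 / lam) * (-3 * ε / lam)) = B at *
  generalize Real.cosh (R / lam) / Real.sinh (R / lam) - 1 = q at *
  rw [e5]
  rw [e3] at k1 ⊢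
  generalize Real.exp (-(R / lam)) = x at *
  have b1 : |massG lam T₀ ε (x ^ 3) - 16 * ε / lam ^ 2 * Real.tanh (T₀ / (2 * lam)) * x ^ 3|
      ≤ |c1| * x ^ 5 := by
    refine k1.trans ?_
    rw [abs_of_nonneg (by positivity : 0 ≤ (x ^ 3) ^ 2)]
    have : (x ^ 3) ^ 2 ≤ x ^ 5 := by
      rw [← pow_mul]; exact pow_le_pow_of_le_one hx0.le hx1 (by norm_num)
    exact mul_le_mul (le_abs_self _) this (by positivity) (abs_nonneg _)
  have b2 : |q * (x ^ 3 * B)| ≤ 4 * |c2| * x ^ 5 := by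
    rw [abs_mul, abs_mul, abs_of_pos (by positivity : 0 < x ^ 3)]
    calc |q| * (x ^ 3 * |B|) ≤ (4 * x ^ 2) * (x ^ 3 * |c2|) := by
          have hB : |B| ≤ |c2| := k2.trans (le_abs_self _)
          exact mul_le_mul hcoth (mul_le_mul_of_nonneg_left hB (by positivity))
            (by positivity) (by positivity)
      _ = _ := by ring
  calc _ = |(massG lam T₀ ε (x ^ 3) - 16 * ε / lam ^ 2 * Real.tanh (T₀ / (2 * lam)) * x ^ 3)
        + q * (x ^ 3 * B)| := by congr 1; ring
    _ ≤ _ := abs_add_le _ _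
    _ ≤ _ := add_le_add b1 b2
    _ = _ := by ring
end
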